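/- Let A be a finite set, d ∈ ℕ, P a probability distribution on A, and ξ : A → density matrices on ℂ^d. Suppose there exist a, a' ∈ A with P(a) > 0, P(a') > 0 and ξ(a)ξ(a') ≠ ξ(a')ξ(a) (the weighted ensemble operators do not all commute). Then for every finite set B and every POVM {M(b)}_{b∈B} on ℂ^d, the Shannon mutual information between input a ~ P and the outcome of measuring ξ(a) with {M(b)} is strictly less than the Holevo quantity χ(P,ξ) = H(Σ_a P(a)ξ(a)) − Σ_a P(a)H(ξ(a)). -/

import Mathlib

open scoped BigOperators ComplexOrder

noncomputable section

namespace QKD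

/-- A probability distribution on a finite type. -/
def IsProbDist {α : Type*} [Fintype α] (P : α → ℝ) : Prop :=
  (∀ a, 0 ≤ P a) ∧ ∑ a, P a = 1

/-- A classical channel (stochastic matrix) from `α` to `β`. -/
def IsChannel {α β : Type*} [Fintype α] [Fintype β] (V : α → β → ℝ) : Prop :=
  (∀ a b, 0 ≤ V a b) ∧ ∀ a, ∑ b, V a b = 1

/-- Shannon entropy, in bits. -/
def entropy {α : Type*} [Fintype α] (P : α → ℝ) : ℝ :=
  (∑ a, Real.negMulLog (P a)) / Real.log 2

/-- Shannon mutual information (in bits) of a joint distribution on `α × β`. -/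
def miJoint {α β : Type*} [Fintype α] [Fintype β] (J : α → β → ℝ) : ℝ :=
  entropy (fun a => ∑ b, J a b) + entropy (fun b => ∑ a, J a b)
    - entropy (fun p : α × β => J p.1 p.2)

/-- `I(P,V)`: mutual information between input distributed by `P` and output of channel `V`. -/
def chanMI {α β : Type*} [Fintype α] [Fintype β] (P : α → ℝ) (V : α → β → ℝ) : ℝ :=
  miJoint (fun a b => P a * V a b)

/-- The n-fold memoryless extension of a channel. -/
def nfold {α β : Type*} (n : ℕ) (V : α → β → ℝ) : (Fin n → α) → (Fin n → β) → ℝ :=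
  fun a b => ∏ i, V (a i) (b i)

/-- Joint distribution of Alice's key `K_A` (uniform on `K`) and the key obtained
by sending `K_A` through the random coder `F`, the channel `V`, and the decoder `f`. -/
def keyJoint {K A B : Type*} [Fintype K] [Fintype A] [Fintype B] [DecidableEq K]
    (F : K → A → ℝ) (V : A → B → ℝ) (f : B → K) : K → K → ℝ :=
  fun k k' => (Fintype.card K : ℝ)⁻¹ * ∑ a, F k a * ∑ b, if f b = k' then V a b else 0

/-- A density matrix: positive semidefinite with trace 1. -/
def IsDensity {ι : Type*} [Fintype ι] (ρ : Matrix ι ι ℂ) : Prop :=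
  ρ.PosSemidef ∧ ρ.trace = 1

/-- A POVM with outcomes in `B`: positive semidefinite operators summing to the identity. -/
def IsPOVM {ι B : Type*} [Fintype ι] [DecidableEq ι] [Fintype B]
    (M : B → Matrix ι ι ℂ) : Prop :=
  (∀ b, (M b).PosSemidef) ∧ ∑ b, M b = 1

/-- Von Neumann entropy (in bits) of a Hermitian matrix, via its eigenvalues. -/
def vnEntropy {ι : Type*} [Fintype ι] [DecidableEq ι] (ρ : Matrix ι ι ℂ) : ℝ :=
  if h : ρ.IsHermitian then (∑ i, Real.negMulLog (h.eigenvalues i)) / Real.log 2 else 0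

/-- The Holevo quantity χ(P, ξ) of the ensemble `{P(a), ξ(a)}`. -/
def holevo {A ι : Type*} [Fintype A] [Fintype ι] [DecidableEq ι]
    (P : A → ℝ) (ξ : A → Matrix ι ι ℂ) : ℝ :=
  vnEntropy (∑ a, (P a : ℂ) • ξ a) - ∑ a, P a * vnEntropy (ξ a)

/-- Probability of outcome `b` when measuring the state `ρ` with the POVM `M`. -/
def measProb {ι B : Type*} [Fintype ι] (M : B → Matrix ι ι ℂ)
    (ρ : Matrix ι ι ℂ) (b : B) : ℝ :=
  ((M b * ρ).trace).re

/-- Mutual information (in bits) between an input `a ~ P` and the outcome of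
measuring `ξ(a)` with the POVM `M`. -/
def measMI {A ι B : Type*} [Fintype A] [Fintype ι] [Fintype B]
    (P : A → ℝ) (ξ : A → Matrix ι ι ℂ) (M : B → Matrix ι ι ℂ) : ℝ :=
  miJoint (fun a b => P a * measProb M (ξ a) b)

/-- The tensor-power state `ξ(a₁) ⊗ ⋯ ⊗ ξ(a_n)`. -/
def tensPow {A ι : Type*} {n : ℕ} (ξ : A → Matrix ι ι ℂ) (a : Fin n → A) :
    Matrix (Fin n → ι) (Fin n → ι) ℂ :=
  Matrix.of fun v w => ∏ i, ξ (a i) (v i) (w i)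

/-- The set of Holevo quantities over all input distributions. -/
def holevoSet {A ι : Type*} [Fintype A] [Fintype ι] [DecidableEq ι]
    (ξ : A → Matrix ι ι ℂ) : Set ℝ :=
  { x | ∃ P : A → ℝ, IsProbDist P ∧ x = holevo P ξ }

/-- The set of accessible informations: mutual informations achievable with some
input distribution and some POVM (with an arbitrary finite outcome set). -/
def accInfoSet {A ι : Type*} [Fintype A] [Fintype ι] [DecidableEq ι]
    (ξ : A → Matrix ι ι ℂ) : Set ℝ :=
  { x | ∃ (P : A → ℝ) (m : ℕ) (M : Fin m → Matrix ι ι ℂ),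
      IsProbDist P ∧ IsPOVM M ∧ x = measMI P ξ M }


lemma scal_pos : ∀ s r l : ℝ, 0 < s → 0 < r → 0 ≤ l → l ≤ 1 → 0 < (1 - l) * r + l * s := by
  intro s r l hs hr h0 h1
  rcases eq_or_lt_of_le h0 with rfl | h0
  · simpa using hr
  · have := mul_pos h0 hs
    have := mul_nonneg (sub_nonneg.2 h1) hr.le
    linarith

lemma scal_cont : ∀ {I : Type _} [Fintype I] (c s r : I → ℝ),
    (∀ i, c i ≠ 0 → 0 < s i ∧ 0 < r i) →
    ContinuousOn (fun l : ℝ => ∑ i, c i * Real.log ((1 - l) * r i + l * s i)) (Set.Icc 0 1) := by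
  intro I _ c s r h
  refine continuousOn_finsetSum _ fun i _ => ?_
  by_cases hi : c i = 0
  · simp only [hi, zero_mul]; exact continuousOn_const
  · refine ContinuousOn.mul continuousOn_const (ContinuousOn.log (by fun_prop) ?_)
    intro l hl
    exact (scal_pos _ _ _ (h i hi).1 (h i hi).2 hl.1 hl.2).ne'
lemma scal_der : ∀ {I : Type _} [Fintype I] (c s r : I → ℝ),
    (∀ i, c i ≠ 0 → 0 < s i ∧ 0 < r i) → ∀ l : ℝ, 0 < l → l < 1 →
    HasDerivAt (fun l : ℝ => ∑ i, c i * Real.log ((1 - l) * r i + l * s i))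
      ((1 - l)⁻¹ * (∑ i, c i * s i / ((1 - l) * r i + l * s i) - ∑ i, c i)) l := by
  intro I _ c s r h l h0 h1
  rw [← Finset.sum_sub_distrib, Finset.mul_sum]
  refine HasDerivAt.fun_sum fun i _ => ?_
  by_cases hi : c i = 0
  · simp only [hi, zero_mul, zero_div, sub_zero, mul_zero]; exact hasDerivAt_const _ _
  · have hp := scal_pos _ _ _ (h i hi).1 (h i hi).2 h0.le h1.le
    have h3 : (1 - l) ≠ 0 := by linarith
    have h2 : HasDerivAt (fun l : ℝ => (1 - l) * r i + l * s i) (s i - r i) l := by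
      have := (((hasDerivAt_id l).const_sub 1).mul_const (r i)).add
        ((hasDerivAt_id l).mul_const (s i))
      exact this.congr_deriv (by ring)
    refine ((h2.log hp.ne').const_mul (c i)).congr_deriv ?_
    have h4 := hp.ne'
    generalize hm : (1 - l) * r i + l * s i = m at *
    field_simp
    rw [← hm]
    ring

lemma scal_cont0 : ∀ {I : Type _} [Fintype I] (c s r : I → ℝ),
    (∀ i, c i ≠ 0 → 0 < s i ∧ 0 < r i) →
    ContinuousAt (fun l : ℝ => ∑ i, c i * s i / ((1 - l) * r i + l * s i)) 0 := by
  intro I _ c s r h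
  refine tendsto_finsetSum _ fun i _ => ?_
  by_cases hi : c i = 0
  · simp only [hi, zero_mul, zero_div]; exact tendsto_const_nhds
  · refine ContinuousAt.div (by fun_prop) (by fun_prop) ?_
    simpa using (h i hi).2.ne'

lemma scalar_mono {I K : Type*} [Fintype I] [Fintype K]
    (c s r : I → ℝ) (c' s' r' : K → ℝ)
    (h : ∀ i, c i ≠ 0 → 0 < s i ∧ 0 < r i) (h' : ∀ i, c' i ≠ 0 → 0 < s' i ∧ 0 < r' i)
    (hc : ∑ i, c i = ∑ i, c' i)
    (hψ : ∀ l : ℝ, 0 ≤ l → l < 1 → ∑ i, c' i * s' i / ((1 - l) * r' i + l * s' i)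
      ≤ ∑ i, c i * s i / ((1 - l) * r i + l * s i)) :
    ∑ i, c' i * (Real.log (s' i) - Real.log (r' i)) ≤ ∑ i, c i * (Real.log (s i) - Real.log (r i))
    ∧ (∑ i, c' i * (Real.log (s' i) - Real.log (r' i))
        = ∑ i, c i * (Real.log (s i) - Real.log (r i)) →
      ∑ i, c' i * s' i / r' i = ∑ i, c i * s i / r i) := by
  set Φ : ℝ → ℝ := fun l => ∑ i, c i * Real.log ((1 - l) * r i + l * s i)
    - ∑ i, c' i * Real.log ((1 - l) * r' i + l * s' i) with hΦ
  have hcont : ContinuousOn Φ (Set.Icc 0 1) := (scal_cont c s r h).sub (scal_cont c' s' r' h')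
  have hder : ∀ l : ℝ, 0 < l → l < 1 → HasDerivAt Φ ((1 - l)⁻¹ *
      (∑ i, c i * s i / ((1 - l) * r i + l * s i)
        - ∑ i, c' i * s' i / ((1 - l) * r' i + l * s' i))) l := by
    intro l h0 h1
    refine ((scal_der c s r h l h0 h1).sub (scal_der c' s' r' h' l h0 h1)).congr_deriv ?_
    rw [hc]; ring
  have hmono : MonotoneOn Φ (Set.Icc 0 1) := by
    refine monotoneOn_of_deriv_nonneg (convex_Icc 0 1) hcont ?_ ?_
    · intro l hl
      rw [interior_Icc] at hl
      exact (hder l hl.1 hl.2).differentiableAt.differentiableWithinAt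
    · intro l hl
      rw [interior_Icc] at hl
      rw [(hder l hl.1 hl.2).deriv]
      have := hψ l hl.1.le hl.2
      exact mul_nonneg (inv_nonneg.2 (by linarith [hl.2])) (by linarith)
  have hends : Φ 1 - Φ 0 = ∑ i, c i * (Real.log (s i) - Real.log (r i))
      - ∑ i, c' i * (Real.log (s' i) - Real.log (r' i)) := by
    simp only [hΦ, sub_self, zero_mul, one_mul, zero_add, sub_zero, add_zero, mul_sub,
      Finset.sum_sub_distrib]
    ring
  have h01 := hmono (Set.left_mem_Icc.2 zero_le_one) (Set.right_mem_Icc.2 zero_le_one) zero_le_one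
  refine ⟨by linarith, fun heq => ?_⟩
  have hΦe : Φ 1 = Φ 0 := by linarith
  have hconst : ∀ l ∈ Set.Icc (0:ℝ) 1, Φ l = Φ 0 := fun l hl =>
    le_antisymm (hΦe ▸ hmono hl (Set.right_mem_Icc.2 zero_le_one) hl.2)
      (hmono (Set.left_mem_Icc.2 zero_le_one) hl hl.1)
  have hz : ∀ l ∈ Set.Ioo (0:ℝ) 1, ∑ i, c i * s i / ((1 - l) * r i + l * s i)
        = ∑ i, c' i * s' i / ((1 - l) * r' i + l * s' i) := by
    intro l hl
    have h1 := hder l hl.1 hl.2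
    have h2 : HasDerivAt Φ 0 l := by
      refine (hasDerivAt_const l (Φ 0)).congr_of_eventuallyEq ?_
      filter_upwards [Ioo_mem_nhds hl.1 hl.2] with x hx
      exact hconst x (Set.Ioo_subset_Icc_self hx)
    have h3 := h1.unique h2
    have h4 : (1 - l)⁻¹ ≠ 0 := inv_ne_zero (by linarith [hl.2])
    have := (mul_eq_zero.1 h3).resolve_left h4
    linarith
  have t1 := (scal_cont0 c s r h).tendsto.mono_left (nhdsWithin_le_nhds (s := Set.Ioi 0))
  have t2 := (scal_cont0 c' s' r' h').tendsto.mono_left (nhdsWithin_le_nhds (s := Set.Ioi 0))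
  have t3 := t1.congr' (by
    filter_upwards [Ioo_mem_nhdsGT (zero_lt_one (α := ℝ))] with l hl using hz l hl)
  have := tendsto_nhds_unique t2 t3
  simpa using this
open Matrix

lemma psd_factor {n : Type*} [Fintype n] [DecidableEq n] {A : Matrix n n ℂ} (hA : A.PosSemidef) :
    ∃ N : Matrix n n ℂ, A = Nᴴ * N := by
  open scoped MatrixOrder in
  exact CStarAlgebra.nonneg_iff_eq_star_mul_self.1 hA.nonneg

lemma trace_sandwich {n : Type*} [Fintype n] [DecidableEq n] {R M : Matrix n n ℂ}
    (hR : R.PosSemidef) (hM : M.PosSemidef) (Y : Matrix n n ℂ) :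
    0 ≤ (R * (Yᴴ * M * Y)).trace.re ∧ ((R * (Yᴴ * M * Y)).trace.re = 0 → M * Y * R = 0) := by
  obtain ⟨N, rfl⟩ := psd_factor hM
  obtain ⟨S, rfl⟩ := psd_factor hR
  have e : (Sᴴ * S * (Yᴴ * (Nᴴ * N) * Y)).trace = ((N * Y * Sᴴ)ᴴ * (N * Y * Sᴴ)).trace := by
    rw [Matrix.mul_assoc, Matrix.trace_mul_comm]
    simp only [conjTranspose_mul, conjTranspose_conjTranspose, Matrix.mul_assoc]
  have hp := (posSemidef_conjTranspose_mul_self (N * Y * Sᴴ)).trace_nonneg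
  rw [e]
  rw [Complex.nonneg_iff] at hp
  refine ⟨hp.1, fun h0 => ?_⟩
  have h1 : N * Y * Sᴴ = 0 := trace_conjTranspose_mul_self_eq_zero_iff.1
    (Complex.ext h0 hp.2.symm)
  calc Nᴴ * N * Y * (Sᴴ * S) = Nᴴ * (N * Y * Sᴴ) * S := by simp only [Matrix.mul_assoc]
    _ = 0 := by rw [h1]; simp

/-- The quadratic-form identity: completing the square for `X ↦ 2 Tr σX - Tr τX²`. -/
lemma quad_identity {n : Type*} [Fintype n] [DecidableEq n]
    {σ ρ U V : Matrix n n ℂ} {s r : n → ℝ}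
    (hU : Uᴴ * U = 1) (hV : Vᴴ * V = 1)
    (hσ : σ = U * diagonal (fun i => (s i : ℂ)) * Uᴴ)
    (hρ : ρ = V * diagonal (fun i => (r i : ℂ)) * Vᴴ)
    (hs : ∀ i, 0 ≤ s i) (hr : ∀ i, 0 ≤ r i)
    (hsr : ∀ i j, s i * Complex.normSq ((Uᴴ * V) i j) ≠ 0 → 0 < s i ∧ 0 < r j)
    (X : Matrix n n ℂ) (hX : Xᴴ = X) (l : ℝ) (h0 : 0 ≤ l) (h1 : l < 1) :
    let w := fun i j => Complex.normSq ((Uᴴ * V) i j)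
    let m := fun i j => (1 - l) * r j + l * s i
    ∑ i, ∑ j, (s i * w i j) * s i / m i j
      = 2 * (X * σ).trace.re - (1 - l) * (X * X * ρ).trace.re - l * (X * X * σ).trace.re
        + ∑ i, ∑ j, m i j * Complex.normSq ((Uᴴ * X * V) i j - (s i / m i j : ℝ) * (Uᴴ * V) i j) := by
  intro w m
  have hV' : V * Vᴴ = 1 := mul_eq_one_comm.1 hV
  have hU' : U * Uᴴ = 1 := mul_eq_one_comm.1 hU
  set T := Uᴴ * X * V with hT
  set W := Uᴴ * V with hW
  have t1 : (X * σ).trace = ∑ i, ∑ j, (s i : ℂ) * T i j * star (W i j) := by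
    have : (X * σ).trace = (diagonal (fun i => (s i : ℂ)) * T * Wᴴ).trace := by
      calc (X * σ).trace = ((X * U) * (diagonal (fun i => (s i : ℂ)) * Uᴴ)).trace := by
            rw [hσ]; simp only [Matrix.mul_assoc]
        _ = (diagonal (fun i => (s i : ℂ)) * Uᴴ * X * (V * Vᴴ) * U).trace := by
            rw [Matrix.trace_mul_comm, hV']; simp only [Matrix.mul_assoc, Matrix.one_mul]
        _ = _ := by
            rw [hT, hW]
            simp only [Matrix.mul_assoc, conjTranspose_mul, conjTranspose_conjTranspose]
    rw [this]
    simp only [trace, diag_apply, Matrix.mul_apply (N := Wᴴ), diagonal_mul, conjTranspose_apply]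
  have t2 : (X * X * ρ).trace = ∑ i, ∑ j, T i j * (r j : ℂ) * star (T i j) := by
    have : (X * X * ρ).trace = (T * diagonal (fun i => (r i : ℂ)) * Tᴴ).trace := by
      calc (X * X * ρ).trace = (X * (X * ρ) * (U * Uᴴ)).trace := by
            rw [hU', Matrix.mul_one]; simp only [Matrix.mul_assoc]
        _ = (X * ρ * U * Uᴴ * X).trace := by
            rw [Matrix.mul_assoc X, Matrix.trace_mul_comm]
            simp only [Matrix.mul_assoc]
        _ = (X * ρ * X).trace := by
            rw [Matrix.mul_assoc (X * ρ), hU', Matrix.mul_one]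
        _ = (X * ρ * X * (U * Uᴴ)).trace := by rw [hU', Matrix.mul_one]
        _ = (Uᴴ * (X * ρ * X * U)).trace := by
            rw [← Matrix.mul_assoc, Matrix.trace_mul_comm]
        _ = _ := by
            rw [hT, hρ]
            simp only [Matrix.mul_assoc, conjTranspose_mul, conjTranspose_conjTranspose, hX]
    rw [this]
    simp only [trace, diag_apply, Matrix.mul_apply (N := Tᴴ), mul_diagonal, conjTranspose_apply]
  have t3 : (X * X * σ).trace = ∑ i, ∑ j, star (T i j) * (s i : ℂ) * T i j := by
    have : (X * X * σ).trace = (Tᴴ * diagonal (fun i => (s i : ℂ)) * T).trace := by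
      calc (X * X * σ).trace = (X * σ * X).trace := by
            rw [Matrix.mul_assoc X, Matrix.trace_mul_comm]
        _ = (X * σ * X * (V * Vᴴ)).trace := by rw [hV', Matrix.mul_one]
        _ = (Vᴴ * (X * σ * X * V)).trace := by
            rw [← Matrix.mul_assoc, Matrix.trace_mul_comm]
        _ = _ := by
            rw [hT, hσ]
            simp only [Matrix.mul_assoc, conjTranspose_mul, conjTranspose_conjTranspose, hX]
    rw [this]
    simp only [trace, diag_apply, Matrix.mul_apply (N := T), mul_diagonal, conjTranspose_apply]
    exact Finset.sum_comm
  rw [t1, t2, t3]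
  simp only [Complex.re_sum, Finset.mul_sum, ← Finset.sum_sub_distrib, ← Finset.sum_add_distrib]
  refine Finset.sum_congr rfl fun i _ => Finset.sum_congr rfl fun j _ => ?_
  have hm0 : 0 ≤ m i j := add_nonneg (mul_nonneg (by linarith) (hr j)) (mul_nonneg h0 (hs i))
  have hmd : m i j = (1 - l) * r j + l * s i := rfl
  have hwd : w i j = Complex.normSq (W i j) := rfl
  have key : 0 < m i j ∨ s i * Complex.normSq (W i j) = 0 ∧ m i j = 0 := by
    rcases hm0.eq_or_lt with h | h
    · right
      refine ⟨?_, h.symm⟩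
      by_contra hne
      have := (hsr i j hne)
      have h2 := scal_pos _ _ _ this.1 this.2 h0 h1.le
      exact (h2.ne' (h.symm)).elim
    · exact Or.inl h
  have eq2 : ((s i : ℂ) * T i j * star (W i j)).re
      = s i * ((T i j).re * (W i j).re + (T i j).im * (W i j).im) := by
    simp; ring
  have eq3 : (T i j * (r j : ℂ) * star (T i j)).re = r j * Complex.normSq (T i j) := by
    simp [Complex.normSq_apply]; ring
  have eq4 : (star (T i j) * (s i : ℂ) * T i j).re = s i * Complex.normSq (T i j) := by
    simp [Complex.normSq_apply]; ring
  rw [eq2, eq3, eq4, hwd]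
  have eq5 : Complex.normSq (T i j - ((s i / m i j : ℝ) : ℂ) * W i j)
      = ((T i j).re - s i / m i j * (W i j).re)^2 + ((T i j).im - s i / m i j * (W i j).im)^2 := by
    simp [Complex.normSq_apply]; ring
  have eq6 : (1 - l) * (r j * Complex.normSq (T i j)) = 
      m i j * Complex.normSq (T i j) - l * (s i * Complex.normSq (T i j)) := by
    rw [hmd]; ring
  rw [eq5, eq6]
  rcases key with hm | ⟨hz, hm⟩
  · have := hm.ne'
    simp only [Complex.normSq_apply]
    field_simp
    ring
  · rw [hm]
    rcases mul_eq_zero.1 hz with h | h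
    · simp [h]
    · have := Complex.normSq_eq_zero.1 h
      simp [this]

lemma povm_gap {n B : Type*} [Fintype n] [DecidableEq n] [Fintype B]
    (M : B → Matrix n n ℂ) (hsum : ∑ b, M b = 1) (x : B → ℝ) :
    ∑ b, ((x b : ℂ)^2) • M b - (∑ b, (x b : ℂ) • M b) * (∑ b, (x b : ℂ) • M b)
      = ∑ b, ((x b : ℂ) • 1 - ∑ b, (x b : ℂ) • M b) * M b * ((x b : ℂ) • 1 - ∑ b, (x b : ℂ) • M b)
      := by
  set X := ∑ b, (x b : ℂ) • M b with hX
  have : ∀ b, ((x b : ℂ) • 1 - X) * M b * ((x b : ℂ) • 1 - X)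
      = ((x b : ℂ)^2) • M b - ((x b : ℂ) • M b) * X - X * ((x b : ℂ) • M b) + X * M b * X := by
    intro b
    simp only [sub_mul, mul_sub, smul_mul_assoc, mul_smul_comm, Matrix.one_mul, Matrix.mul_one,
      smul_sub, smul_smul, pow_two]
    abel
  simp only [this, Finset.sum_add_distrib, Finset.sum_sub_distrib, ← Finset.sum_mul,
    ← Finset.mul_sum, hsum, ← hX]
  simp

lemma trace_gap {n B : Type*} [Fintype n] [DecidableEq n] [Fintype B]
    (M : B → Matrix n n ℂ) (hsum : ∑ b, M b = 1) (x : B → ℝ) (τ : Matrix n n ℂ) :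
    ((∑ b, (x b : ℂ) • M b) * (∑ b, (x b : ℂ) • M b) * τ).trace.re
      = ∑ b, (x b)^2 * (M b * τ).trace.re
        - ∑ b, (τ * (((x b : ℂ) • 1 - ∑ b, (x b : ℂ) • M b) * M b *
            ((x b : ℂ) • 1 - ∑ b, (x b : ℂ) • M b))).trace.re := by
  have h := povm_gap M hsum x
  have h2 : (∑ b, (x b : ℂ) • M b) * (∑ b, (x b : ℂ) • M b)
      = ∑ b, ((x b : ℂ)^2) • M b - ∑ b, ((x b : ℂ) • 1 - ∑ b, (x b : ℂ) • M b) * M b *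
            ((x b : ℂ) • 1 - ∑ b, (x b : ℂ) • M b) := by
    rw [← h]; abel
  rw [h2, sub_mul, trace_sub, Complex.sub_re, trace_mul_comm (∑ b, (_ * _ * _)) τ,
    Finset.sum_mul, Finset.mul_sum, trace_sum, trace_sum, Complex.re_sum, Complex.re_sum]
  congr 1
  refine Finset.sum_congr rfl fun b _ => ?_
  rw [smul_mul_assoc, trace_smul, smul_eq_mul, ← Complex.ofReal_pow, Complex.re_ofReal_mul]

lemma core {n B : Type*} [Fintype n] [DecidableEq n] [Fintype B]
    {σ ρ U V : Matrix n n ℂ} {s r : n → ℝ}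
    (hU : Uᴴ * U = 1) (hV : Vᴴ * V = 1)
    (hσ : σ = U * diagonal (fun i => (s i : ℂ)) * Uᴴ)
    (hρ : ρ = V * diagonal (fun i => (r i : ℂ)) * Vᴴ)
    (hs : ∀ i, 0 ≤ s i) (hr : ∀ i, 0 ≤ r i)
    (hsr : ∀ i j, s i * Complex.normSq ((Uᴴ * V) i j) ≠ 0 → 0 < s i ∧ 0 < r j)
    (hσp : σ.PosSemidef) (hρp : ρ.PosSemidef)
    (M : B → Matrix n n ℂ) (hM : ∀ b, (M b).PosSemidef) (hsum : ∑ b, M b = 1) :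
    let w := fun i j => Complex.normSq ((Uᴴ * V) i j)
    let q := fun b => (M b * σ).trace.re
    let p := fun b => (M b * ρ).trace.re
    (∀ l : ℝ, 0 ≤ l → l < 1 → ∑ b, q b * q b / ((1 - l) * p b + l * q b) ≤
      ∑ i, ∑ j, (s i * w i j) * s i / ((1 - l) * r j + l * s i)) ∧
    (∑ b, q b * q b / p b = ∑ i, ∑ j, (s i * w i j) * s i / r j →
      σ * ρ = ρ * σ ∧ ∀ b, M b * σ = ((q b / p b : ℝ) : ℂ) • (M b * ρ)) := by
  intro w q p
  have gap : ∀ l : ℝ, 0 ≤ l → l < 1 → ∀ x : B → ℝ,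
      (∀ b, x b = q b / ((1 - l) * p b + l * q b)) →
      ∑ i, ∑ j, (s i * w i j) * s i / ((1 - l) * r j + l * s i)
      = ∑ b, q b * q b / ((1 - l) * p b + l * q b)
        + (1 - l) * ∑ b, (ρ * (((x b : ℂ) • 1 - ∑ b, (x b : ℂ) • M b) * M b *
            ((x b : ℂ) • 1 - ∑ b, (x b : ℂ) • M b))).trace.re
        + l * ∑ b, (σ * (((x b : ℂ) • 1 - ∑ b, (x b : ℂ) • M b) * M b *
            ((x b : ℂ) • 1 - ∑ b, (x b : ℂ) • M b))).trace.re
        + ∑ i, ∑ j, ((1 - l) * r j + l * s i) *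
          Complex.normSq ((Uᴴ * (∑ b, (x b : ℂ) • M b) * V) i j
            - (s i / ((1 - l) * r j + l * s i) : ℝ) * (Uᴴ * V) i j) := by
    intro l h0 h1 x hx
    have hXh : (∑ b, (x b : ℂ) • M b)ᴴ = ∑ b, (x b : ℂ) • M b := by
      rw [conjTranspose_sum]
      refine Finset.sum_congr rfl fun b _ => ?_
      rw [conjTranspose_smul, (hM b).isHermitian.eq]
      simp
    have h := quad_identity hU hV hσ hρ hs hr hsr _ hXh l h0 h1
    simp only at h
    refine h.trans ?_
    rw [trace_gap M hsum x ρ, trace_gap M hsum x σ]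
    have e1 : ((∑ b, (x b : ℂ) • M b) * σ).trace.re = ∑ b, x b * q b := by
      rw [Finset.sum_mul, trace_sum, Complex.re_sum]
      refine Finset.sum_congr rfl fun b _ => ?_
      rw [smul_mul_assoc, trace_smul, smul_eq_mul, Complex.re_ofReal_mul]
    have e2 : ∑ b, q b * q b / ((1 - l) * p b + l * q b)
        = 2 * ∑ b, x b * q b - (1 - l) * ∑ b, x b ^ 2 * p b - l * ∑ b, x b ^ 2 * q b := by
      simp only [Finset.mul_sum, ← Finset.sum_sub_distrib]
      refine Finset.sum_congr rfl fun b _ => ?_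
      have : 2 * (x b * q b) - (1 - l) * (x b ^ 2 * p b) - l * (x b ^ 2 * q b)
        = 2 * (x b * q b) - x b ^ 2 * ((1 - l) * p b + l * q b) := by ring
      rw [this, hx]
      generalize (1 - l) * p b + l * q b = m
      by_cases hm : m = 0
      · simp [hm]
      · field_simp
        ring
    rw [e1, e2]
    ring
  have hXh : ∀ x : B → ℝ, (∑ b, (x b : ℂ) • M b)ᴴ = ∑ b, (x b : ℂ) • M b := by
    intro x
    rw [conjTranspose_sum]
    refine Finset.sum_congr rfl fun b _ => ?_
    rw [conjTranspose_smul, (hM b).isHermitian.eq]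
    simp
  have hYh : ∀ (x : B → ℝ) b, ((x b : ℂ) • (1 : Matrix n n ℂ) - ∑ b, (x b : ℂ) • M b)ᴴ
      = (x b : ℂ) • 1 - ∑ b, (x b : ℂ) • M b := by
    intro x b
    rw [conjTranspose_sub, hXh, conjTranspose_smul]
    simp
  have hG : ∀ (x : B → ℝ) {τ : Matrix n n ℂ}, τ.PosSemidef → ∀ b,
      0 ≤ (τ * (((x b : ℂ) • 1 - ∑ b, (x b : ℂ) • M b) * M b *
            ((x b : ℂ) • 1 - ∑ b, (x b : ℂ) • M b))).trace.re := by
    intro x τ hτ b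
    have := (trace_sandwich hτ (hM b) ((x b : ℂ) • 1 - ∑ b, (x b : ℂ) • M b)).1
    rwa [hYh] at this
  have hm : ∀ l : ℝ, 0 ≤ l → l < 1 → ∀ i j, 0 ≤ (1 - l) * r j + l * s i := fun l h0 h1 i j =>
    add_nonneg (mul_nonneg (by linarith) (hr j)) (mul_nonneg h0 (hs i))
  constructor
  · intro l h0 h1
    rw [gap l h0 h1 _ fun b => rfl]
    rw [add_assoc, add_assoc]
    refine le_add_of_nonneg_right (add_nonneg ?_ (add_nonneg ?_ ?_))
    · exact mul_nonneg (by linarith) (Finset.sum_nonneg fun b _ =>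
        hG (fun b => q b / ((1 - l) * p b + l * q b)) hρp b)
    · exact mul_nonneg h0 (Finset.sum_nonneg fun b _ =>
        hG (fun b => q b / ((1 - l) * p b + l * q b)) hσp b)
    · exact Finset.sum_nonneg fun i _ => Finset.sum_nonneg fun j _ =>
        mul_nonneg (hm l h0 h1 i j) (Complex.normSq_nonneg _)
  · intro heq
    set x : B → ℝ := fun b => q b / p b with hx
    have g := gap 0 le_rfl one_pos x (by intro b; simp [hx])
    simp only [sub_zero, one_mul, zero_mul, add_zero] at g
    rw [← heq] at g
    set X := ∑ b, (x b : ℂ) • M b with hXdef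
    have n1 : 0 ≤ ∑ b, (ρ * (((x b : ℂ) • 1 - X) * M b * ((x b : ℂ) • 1 - X))).trace.re :=
      Finset.sum_nonneg fun b _ => hG x hρp b
    have n2' : ∀ i j, 0 ≤ r j * Complex.normSq ((Uᴴ * X * V) i j
        - (s i / r j : ℝ) * (Uᴴ * V) i j) := fun i j => mul_nonneg (hr j) (Complex.normSq_nonneg _)
    have n2 := Finset.sum_nonneg fun i (_ : i ∈ Finset.univ) =>
      Finset.sum_nonneg fun j (_ : j ∈ Finset.univ) => n2' i j
    have z1 : ∑ b, (ρ * (((x b : ℂ) • 1 - X) * M b * ((x b : ℂ) • 1 - X))).trace.re = 0 := by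
      linarith
    have z2 : ∑ i, ∑ j, r j * Complex.normSq ((Uᴴ * X * V) i j
        - (s i / r j : ℝ) * (Uᴴ * V) i j) = 0 := by linarith
    have z1' : ∀ b, M b * ((x b : ℂ) • 1 - X) * ρ = 0 := by
      intro b
      refine (trace_sandwich hρp (hM b) ((x b : ℂ) • 1 - X)).2 ?_
      rw [hYh]
      exact (Finset.sum_eq_zero_iff_of_nonneg fun b _ => hG x hρp b).1 z1 b (Finset.mem_univ _)
    have z2' : ∀ i j, (Uᴴ * X * V) i j * (r j : ℂ) = (s i : ℂ) * (Uᴴ * V) i j := by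
      intro i j
      have a1 := (Finset.sum_eq_zero_iff_of_nonneg fun i _ =>
        Finset.sum_nonneg fun j _ => n2' i j).1 z2 i (Finset.mem_univ _)
      have a2 := (Finset.sum_eq_zero_iff_of_nonneg fun j _ => n2' i j).1 a1 j (Finset.mem_univ _)
      by_cases hrj : r j = 0
      · have : s i * Complex.normSq ((Uᴴ * V) i j) = 0 := by
          by_contra hne
          exact (hsr i j hne).2.ne' hrj
        rcases mul_eq_zero.1 this with h | h
        · simp [hrj, h]
        · simp [hrj, Complex.normSq_eq_zero.1 h]
      · have a3 := Complex.normSq_eq_zero.1 ((mul_eq_zero.1 a2).resolve_left hrj)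
        rw [sub_eq_zero.1 a3]
        have : (r j : ℂ) ≠ 0 := by exact_mod_cast hrj
        push_cast
        field_simp
    have hV' : V * Vᴴ = 1 := mul_eq_one_comm.1 hV
    have hU' : U * Uᴴ = 1 := mul_eq_one_comm.1 hU
    have z3 : Uᴴ * X * V * diagonal (fun i => (r i : ℂ))
        = diagonal (fun i => (s i : ℂ)) * (Uᴴ * V) := by
      ext i j
      rw [mul_diagonal, diagonal_mul]
      exact z2' i j
    have hXρ : X * ρ = σ := by
      calc X * ρ = U * (Uᴴ * X * V * diagonal (fun i => (r i : ℂ))) * Vᴴ := by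
            rw [hρ]
            simp only [← Matrix.mul_assoc, hU', Matrix.one_mul]
        _ = U * diagonal (fun i => (s i : ℂ)) * Uᴴ * (V * Vᴴ) := by
            rw [z3]; simp only [Matrix.mul_assoc]
        _ = σ := by rw [hV', Matrix.mul_one, hσ]
    have hρX : ρ * X = σ := by
      have := congrArg conjTranspose hXρ
      rwa [conjTranspose_mul, hXh, hρp.isHermitian.eq, hσp.isHermitian.eq] at this
    refine ⟨?_, fun b => ?_⟩
    · calc σ * ρ = ρ * X * ρ := by rw [hρX]
        _ = ρ * σ := by rw [Matrix.mul_assoc, hXρ]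
    · have := z1' b
      rw [mul_sub, sub_mul, sub_eq_zero, Matrix.mul_assoc _ X, hXρ] at this
      rw [← this]
      simp [hx]

lemma spec {n : Type*} [Fintype n] [DecidableEq n] {A : Matrix n n ℂ} (hA : A.IsHermitian) :
    ∃ U : Matrix n n ℂ, Uᴴ * U = 1 ∧
      A = U * diagonal (fun i => (hA.eigenvalues i : ℂ)) * Uᴴ := by
  refine ⟨hA.eigenvectorUnitary, ?_, ?_⟩
  · have := (Matrix.mem_unitaryGroup_iff').1 hA.eigenvectorUnitary.2
    exact this
  · have := hA.spectral_theorem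
    rw [Unitary.conjStarAlgAut_apply] at this
    exact this

lemma diag_overlap {n : Type*} [Fintype n] [DecidableEq n] {σ U V : Matrix n n ℂ} {s : n → ℝ}
    (hσ : σ = U * diagonal (fun i => (s i : ℂ)) * Uᴴ) (j : n) :
    ((Vᴴ * σ * V) j j).re = ∑ i, s i * Complex.normSq ((Uᴴ * V) i j) := by
  have : Vᴴ * σ * V = (Uᴴ * V)ᴴ * diagonal (fun i => (s i : ℂ)) * (Uᴴ * V) := by
    rw [hσ]; simp only [Matrix.mul_assoc, conjTranspose_mul, conjTranspose_conjTranspose]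
  rw [this, Matrix.mul_apply, Complex.re_sum]
  refine Finset.sum_congr rfl fun i _ => ?_
  rw [mul_diagonal, conjTranspose_apply]
  simp [Complex.normSq_apply]; ring

lemma overlap_row {n : Type*} [Fintype n] [DecidableEq n] {U V : Matrix n n ℂ}
    (hU : Uᴴ * U = 1) (hV : Vᴴ * V = 1) (i : n) :
    ∑ j, Complex.normSq ((Uᴴ * V) i j) = 1 := by
  have hV' : V * Vᴴ = 1 := mul_eq_one_comm.1 hV
  have h : (Uᴴ * V) * (Uᴴ * V)ᴴ = 1 := by
    rw [conjTranspose_mul, conjTranspose_conjTranspose, Matrix.mul_assoc, ← Matrix.mul_assoc V,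
      hV', Matrix.one_mul, hU]
  have h2 := congrArg (fun N : Matrix n n ℂ => (N i i).re) h
  simp only [Matrix.mul_apply (M := Uᴴ * V), Complex.re_sum, one_apply_eq, Complex.one_re] at h2
  rw [← h2]
  refine Finset.sum_congr rfl fun j _ => ?_
  rw [conjTranspose_apply]
  simp [Complex.normSq_apply]

lemma negMulLog_eq (x : ℝ) : Real.negMulLog x = -(x * Real.log x) := by
  rw [Real.negMulLog]; ring

lemma measMI_eq {A n B : Type*} [Fintype A] [Fintype n] [DecidableEq n] [Fintype B]
    (P : A → ℝ) (ξ : A → Matrix n n ℂ) (M : B → Matrix n n ℂ) (p : B → ℝ)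
    (hp : ∀ b, p b = ∑ a, P a * measProb M (ξ a) b) (hq : ∀ a, ∑ b, measProb M (ξ a) b = 1) :
    measMI P ξ M = (∑ a, P a * ∑ b, measProb M (ξ a) b *
      (Real.log (measProb M (ξ a) b) - Real.log (p b))) / Real.log 2 := by
  unfold measMI miJoint entropy
  rw [← add_div, ← sub_div]
  congr 1
  simp only [← hp, ← Finset.mul_sum, hq, mul_one]
  rw [Fintype.sum_prod_type]
  simp only [Real.negMulLog_mul, Finset.sum_add_distrib, ← Finset.mul_sum, ← Finset.sum_mul, hq,
    one_mul]
  have e : ∑ b, Real.negMulLog (p b) = - ∑ a, P a * ∑ b, measProb M (ξ a) b * Real.log (p b) := by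
    simp only [Finset.mul_sum]
    rw [Finset.sum_comm, ← Finset.sum_neg_distrib]
    refine Finset.sum_congr rfl fun b _ => ?_
    rw [negMulLog_eq]
    conv_lhs => rw [hp b, Finset.sum_mul, ← hp b]
    simp only [mul_assoc]
  rw [e]
  simp only [negMulLog_eq, mul_sub, Finset.sum_sub_distrib, Finset.sum_neg_distrib, mul_neg]
  ring

/-- **Strict Holevo bound for non-commuting ensembles.** If two letters of the
ensemble have positive probability and their states do not commute, then for
every POVM the mutual information between the input `a ~ P` and the measurement
outcome is strictly smaller than the Holevo quantity `χ(P, ξ)`. -/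
theorem holevo_bound_strict_of_noncommuting
    {A : Type*} [Fintype A] {d : ℕ}
    (P : A → ℝ) (hP : IsProbDist P)
    (ξ : A → Matrix (Fin d) (Fin d) ℂ) (hξ : ∀ a, IsDensity (ξ a))
    (hnc : ∃ a a' : A, 0 < P a ∧ 0 < P a' ∧ ξ a * ξ a' ≠ ξ a' * ξ a)
    {B : Type*} [Fintype B]
    (M : B → Matrix (Fin d) (Fin d) ℂ) (hM : IsPOVM M) :
    measMI P ξ M < holevo P ξ := by
  obtain ⟨a₀, a₁, ha₀, ha₁, hne⟩ := hnc
  obtain ⟨hP0, hP1⟩ := hP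
  obtain ⟨hMp, hMs⟩ := hM
  have hξh : ∀ a, (ξ a).IsHermitian := fun a => (hξ a).1.isHermitian
  set ρ := ∑ a, (P a : ℂ) • ξ a with hρdef
  have hρp : ρ.PosSemidef := by
    refine Matrix.posSemidef_sum _ fun a _ => (hξ a).1.smul ?_
    exact_mod_cast hP0 a
  have hρh := hρp.isHermitian
  obtain ⟨V, hV, hρV⟩ := spec hρh
  choose U hU hσU using fun a => spec (hξh a)
  set s := fun a => (hξh a).eigenvalues with hs
  set r := hρh.eigenvalues with hr
  have hs0 : ∀ a i, 0 ≤ s a i := fun a i => (hξ a).1.eigenvalues_nonneg i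
  have hr0 : ∀ i, 0 ≤ r i := fun i => hρp.eigenvalues_nonneg i
  set w := fun a i j => Complex.normSq (((U a)ᴴ * V) i j) with hw
  have hw0 : ∀ a i j, 0 ≤ w a i j := fun a i j => Complex.normSq_nonneg _
  have hrw : ∀ j, r j = ∑ a, P a * ∑ i, s a i * w a i j := by
    intro j
    have e1 : ((Vᴴ * ρ * V) j j).re = r j := by
      have : Vᴴ * ρ * V = diagonal (fun i => (r i : ℂ)) := by
        rw [hρV]
        calc Vᴴ * (V * diagonal (fun i => (r i : ℂ)) * Vᴴ) * V
            = (Vᴴ * V) * diagonal (fun i => (r i : ℂ)) * (Vᴴ * V) := by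
              simp only [Matrix.mul_assoc]
          _ = _ := by rw [hV, Matrix.one_mul, Matrix.mul_one]
      rw [this]; simp
    rw [← e1, hρdef, Finset.mul_sum, Finset.sum_mul, Matrix.sum_apply, Complex.re_sum]
    refine Finset.sum_congr rfl fun a _ => ?_
    rw [← diag_overlap (hσU a) j, mul_smul_comm, smul_mul_assoc, Matrix.smul_apply, smul_eq_mul,
      Complex.re_ofReal_mul]
  set q := fun a b => measProb M (ξ a) b with hq
  set p := fun b => measProb M ρ b with hp
  have hq0 : ∀ a b, 0 ≤ q a b := by
    intro a b
    have := (trace_sandwich (hξ a).1 (hMp b) 1).1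
    rw [Matrix.mul_one, conjTranspose_one, Matrix.one_mul, trace_mul_comm] at this
    exact this
  have hpq : ∀ b, p b = ∑ a, P a * q a b := by
    intro b
    simp only [hp, hq, measProb]
    rw [hρdef, Finset.mul_sum, trace_sum, Complex.re_sum]
    refine Finset.sum_congr rfl fun a _ => ?_
    rw [mul_smul_comm, trace_smul, smul_eq_mul, Complex.re_ofReal_mul]
  have hq1 : ∀ a, ∑ b, q a b = 1 := by
    intro a
    simp only [hq, measProb]
    rw [← Complex.re_sum, ← trace_sum, ← Finset.sum_mul, hMs, Matrix.one_mul, (hξ a).2]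
    simp
  have hw1 : ∀ a i, ∑ j, w a i j = 1 := fun a i => overlap_row (hU a) hV i
  have hs1 : ∀ a, ∑ i, s a i = 1 := by
    intro a
    have := (hξh a).trace_eq_sum_eigenvalues
    rw [(hξ a).2] at this
    have h2 := congrArg Complex.re this
    simpa using h2.symm
  -- supports
  have hsr : ∀ a, 0 < P a → ∀ i j, s a i * w a i j ≠ 0 → 0 < s a i ∧ 0 < r j := by
    intro a ha i j hne
    have h1 : 0 < s a i := lt_of_le_of_ne (hs0 a i) (fun h => hne (by rw [← h, zero_mul]))
    have h2 : 0 < s a i * w a i j := lt_of_le_of_ne (mul_nonneg (hs0 a i) (hw0 a i j)) hne.symm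
    refine ⟨h1, ?_⟩
    rw [hrw j]
    refine lt_of_lt_of_le (mul_pos ha h2) ?_
    refine le_trans (mul_le_mul_of_nonneg_left (Finset.single_le_sum
      (f := fun i => s a i * w a i j) (fun i _ => mul_nonneg (hs0 a i) (hw0 a i j))
      (Finset.mem_univ i)) ha.le) ?_
    exact Finset.single_le_sum (f := fun a => P a * ∑ i, s a i * w a i j)
      (fun a _ => mul_nonneg (hP0 a) (Finset.sum_nonneg fun i _ =>
        mul_nonneg (hs0 a i) (hw0 a i j))) (Finset.mem_univ a)
  have hqp : ∀ a, 0 < P a → ∀ b, q a b ≠ 0 → 0 < q a b ∧ 0 < p b := by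
    intro a ha b hne
    have h1 : 0 < q a b := lt_of_le_of_ne (hq0 a b) hne.symm
    refine ⟨h1, ?_⟩
    rw [hpq b]
    exact lt_of_lt_of_le (mul_pos ha h1) (Finset.single_le_sum (f := fun a => P a * q a b)
      (fun a _ => mul_nonneg (hP0 a) (hq0 a b)) (Finset.mem_univ a))
  -- relative entropies
  set C := fun a => ∑ b, q a b * (Real.log (q a b) - Real.log (p b)) with hC
  set Q := fun a => ∑ i, ∑ j, (s a i * w a i j) * (Real.log (s a i) - Real.log (r j)) with hQ
  have main : ∀ a, 0 < P a → C a ≤ Q a ∧ (C a = Q a →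
      ξ a * ρ = ρ * ξ a ∧ ∀ b, M b * ξ a = ((q a b / p b : ℝ) : ℂ) • (M b * ρ)) := by
    intro a ha
    have hcore := core (hU a) hV (hσU a) hρV (hs0 a) hr0 (hsr a ha) (hξ a).1 hρp M hMp hMs
    obtain ⟨c1, c2⟩ := hcore
    have hsc := scalar_mono (I := Fin d × Fin d) (K := B)
      (fun k => s a k.1 * w a k.1 k.2) (fun k => s a k.1) (fun k => r k.2)
      (q a) (q a) p (fun k hk => hsr a ha k.1 k.2 hk) (hqp a ha)
      (by
        rw [hq1, Fintype.sum_prod_type]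
        simp only [← Finset.mul_sum, hw1, mul_one, hs1])
      (by
        intro l h0 h1
        rw [Fintype.sum_prod_type]
        exact c1 l h0 h1)
    simp only [Fintype.sum_prod_type] at hsc
    exact ⟨hsc.1, fun h => c2 (hsc.2 h)⟩
  have hl2 : 0 < Real.log 2 := Real.log_pos one_lt_two
  have hMI : measMI P ξ M = (∑ a, P a * C a) / Real.log 2 := measMI_eq P ξ M p hpq hq1
  have hHol : holevo P ξ = (∑ a, P a * Q a) / Real.log 2 := by
    have hvn : ∀ a, vnEntropy (ξ a) = (∑ i, Real.negMulLog (s a i)) / Real.log 2 :=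
      fun a => dif_pos (hξh a)
    have hvr : vnEntropy ρ = (∑ i, Real.negMulLog (r i)) / Real.log 2 := dif_pos hρh
    unfold holevo
    rw [← hρdef, hvr]
    simp only [hvn, ← mul_div_assoc]
    rw [← Finset.sum_div, ← sub_div]
    congr 1
    have e1 : ∑ j, Real.negMulLog (r j)
        = - ∑ a, P a * ∑ i, ∑ j, (s a i * w a i j) * Real.log (r j) := by
      have : ∀ j, Real.negMulLog (r j)
          = - ∑ a, P a * ∑ i, (s a i * w a i j) * Real.log (r j) := by
        intro j
        rw [negMulLog_eq]
        conv_lhs => rw [hrw j, Finset.sum_mul, ← hrw j]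
        simp only [mul_assoc, Finset.sum_mul]
      simp only [this]
      rw [Finset.sum_neg_distrib, Finset.sum_comm]
      congr 1
      refine Finset.sum_congr rfl fun a _ => ?_
      rw [← Finset.mul_sum, Finset.sum_comm]
    have e2 : ∀ a, ∑ i, ∑ j, (s a i * w a i j) * Real.log (s a i)
        = - ∑ i, Real.negMulLog (s a i) := by
      intro a
      rw [← Finset.sum_neg_distrib]
      refine Finset.sum_congr rfl fun i _ => ?_
      rw [← Finset.sum_mul, ← Finset.mul_sum, hw1, negMulLog_eq]
      ring
    rw [e1]
    simp only [hQ, mul_sub, Finset.sum_sub_distrib, e2, mul_neg, Finset.sum_neg_distrib]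
    ring
  rw [hMI, hHol]
  refine div_lt_div_of_pos_right ?_ hl2
  have hle : ∀ a, P a * C a ≤ P a * Q a := by
    intro a
    rcases (hP0 a).eq_or_lt with h | h
    · rw [← h]; simp
    · exact mul_le_mul_of_nonneg_left (main a h).1 h.le
  refine lt_of_le_of_ne (Finset.sum_le_sum fun a _ => hle a) fun heq => hne ?_
  have hall := (Finset.sum_eq_sum_iff_of_le fun a _ => hle a).1 heq
  have hcond : ∀ a, 0 < P a → ξ a * ρ = ρ * ξ a ∧
      ∀ b, M b * ξ a = ((q a b / p b : ℝ) : ℂ) • (M b * ρ) := fun a ha =>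
    (main a ha).2 (mul_left_cancel₀ ha.ne' (hall a (Finset.mem_univ a)))
  have hprod : ∀ a a', 0 < P a → 0 < P a' → ∀ b, M b * (ξ a * ξ a')
      = (((q a b / p b : ℝ) : ℂ) * ((q a' b / p b : ℝ) : ℂ)) • (M b * (ρ * ρ)) := by
    intro a a' ha ha' b
    rw [← Matrix.mul_assoc, (hcond a ha).2 b, smul_mul_assoc, Matrix.mul_assoc,
      ← (hcond a' ha').1, ← Matrix.mul_assoc, (hcond a' ha').2 b, smul_mul_assoc, smul_smul,
      Matrix.mul_assoc]
  calc ξ a₀ * ξ a₁ = ∑ b, M b * (ξ a₀ * ξ a₁) := by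
        rw [← Finset.sum_mul, hMs, Matrix.one_mul]
    _ = ∑ b, M b * (ξ a₁ * ξ a₀) := by
        refine Finset.sum_congr rfl fun b _ => ?_
        rw [hprod a₀ a₁ ha₀ ha₁, hprod a₁ a₀ ha₁ ha₀, mul_comm]
    _ = ξ a₁ * ξ a₀ := by rw [← Finset.sum_mul, hMs, Matrix.one_mul]

end QKD
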